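/- Let n ≥ 2 be an integer, set m = (n−3)/2, let κ > 0 be real, let γ be real with |γ| < κ/(2(m+1)), and let c > 1 be real. Then there exists z₀ ∈ (0, m+1) such that for every z ∈ (z₀, m+1) and every real ρ ≥ ρ₊(z) := c·log((m+1)/(m+1−z)), writing a₀ = m + 1 − z and b₀ = 2m + 2, one has 2·(a₀/b₀)·M(a₀+1, b₀+1; ρ) > (1 − 2γz/κ)·M(a₀, b₀; ρ). -/

import Mathlib

/-- The rising factorial (Pochhammer symbol) `(a)_k = a (a+1) ⋯ (a+k-1)`, with `(a)_0 = 1`. -/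
noncomputable def risingFactorial (a : ℝ) (k : ℕ) : ℝ :=
  ∏ i ∈ Finset.range k, (a + i)

/-- The confluent hypergeometric function of the first kind,
`M(a,b;ρ) = ∑_{k=0}^∞ ((a)_k/(b)_k) ρ^k/k!`. -/
noncomputable def CHF_M (a b ρ : ℝ) : ℝ :=
  ∑' k : ℕ, risingFactorial a k / risingFactorial b k * ρ ^ k / (Nat.factorial k : ℝ)

lemma risingFactorial_succ (a : ℝ) (k : ℕ) :
    risingFactorial a (k + 1) = risingFactorial a k * (a + k) :=
  Finset.prod_range_succ _ _

lemma risingFactorial_pos {a : ℝ} (ha : 0 < a) (k : ℕ) : 0 < risingFactorial a k :=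
  Finset.prod_pos fun _ _ => by positivity

lemma mul_risingFactorial_add_one (a : ℝ) (k : ℕ) :
    a * risingFactorial (a + 1) k = risingFactorial a k * (a + k) := by
  induction k with
  | zero => simp [risingFactorial]
  | succ k ih =>
    rw [risingFactorial_succ, risingFactorial_succ, ← mul_assoc, ih]
    push_cast
    ring

lemma risingFactorial_mono {a b : ℝ} (ha : 0 < a) (hab : a ≤ b) (k : ℕ) :
    risingFactorial a k ≤ risingFactorial b k :=
  Finset.prod_le_prod (fun _ _ => by positivity) fun _ _ => by gcongr

/-- The `k`-th term of the series defining `CHF_M a b ρ`. -/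
noncomputable def chfTerm (a b ρ : ℝ) (k : ℕ) : ℝ :=
  risingFactorial a k / risingFactorial b k * ρ ^ k / (Nat.factorial k : ℝ)

lemma chfTerm_nonneg {a b ρ : ℝ} (ha : 0 < a) (hb : 0 < b) (hρ : 0 ≤ ρ) (k : ℕ) :
    0 ≤ chfTerm a b ρ k := by
  have := risingFactorial_pos ha k
  have := risingFactorial_pos hb k
  unfold chfTerm
  positivity

lemma chfTerm_le {a b ρ : ℝ} (ha : 0 < a) (hab : a ≤ b) (hρ : 0 ≤ ρ) (k : ℕ) :
    chfTerm a b ρ k ≤ ρ ^ k / (Nat.factorial k : ℝ) := by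
  have hb := risingFactorial_pos (ha.trans_le hab) k
  have h : risingFactorial a k / risingFactorial b k ≤ 1 :=
    (div_le_one hb).2 (risingFactorial_mono ha hab k)
  unfold chfTerm
  gcongr
  exact mul_le_of_le_one_left (by positivity) h

lemma summable_chfTerm {a b ρ : ℝ} (ha : 0 < a) (hab : a ≤ b) (hρ : 0 ≤ ρ) :
    Summable (chfTerm a b ρ) :=
  Summable.of_nonneg_of_le (chfTerm_nonneg ha (ha.trans_le hab) hρ) (chfTerm_le ha hab hρ)
    (Real.summable_pow_div_factorial ρ)

lemma div_mul_chfTerm_add_one {a b : ℝ} (hb : 0 < b) (ρ : ℝ) (k : ℕ) :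
    a / b * chfTerm (a + 1) (b + 1) ρ k = (a + k) / (b + k) * chfTerm a b ρ k := by
  have hbk := risingFactorial_pos hb k
  have hbk' := risingFactorial_pos (show 0 < b + 1 by positivity) k
  have h : a / b * (risingFactorial (a + 1) k / risingFactorial (b + 1) k) =
      (a + k) / (b + k) * (risingFactorial a k / risingFactorial b k) := by
    rw [div_mul_div_comm, div_mul_div_comm, mul_risingFactorial_add_one,
      mul_risingFactorial_add_one]
    ring
  unfold chfTerm
  rw [mul_div_assoc, mul_div_assoc, ← mul_assoc, ← mul_assoc, h]

lemma chfTerm_succ {a b : ℝ} (ρ : ℝ) (k : ℕ) :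
    chfTerm a b ρ (k + 1) = chfTerm a b ρ k * ((a + k) / (b + k)) * (ρ / (k + 1)) := by
  unfold chfTerm
  rw [risingFactorial_succ, risingFactorial_succ, Nat.factorial_succ, mul_div_mul_comm]
  push_cast
  rw [mul_comm ((k : ℝ) + 1), pow_succ]
  simp only [div_eq_mul_inv, mul_inv]
  ring

/-- Terms of positive index carry a factor `a`. -/
lemma chfTerm_succ_le {a b ρ : ℝ} (ha : 0 < a) (hab : a ≤ b) (hb : 1 ≤ b) (hρ : 0 ≤ ρ) (k : ℕ) :
    chfTerm a b ρ (k + 1) ≤ a * ρ ^ (k + 1) := by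
  induction k with
  | zero =>
    have : a / b ≤ a := div_le_self ha.le hb
    simpa [chfTerm, risingFactorial] using mul_le_mul_of_nonneg_right this hρ
  | succ k ih =>
    have hb0 : 0 < b := by positivity
    have h1 : (a + (k + 1 : ℕ)) / (b + (k + 1 : ℕ)) ≤ 1 :=
      (div_le_one (by positivity)).2 (by gcongr)
    have h2 : ρ / ((k + 1 : ℕ) + 1) ≤ ρ := div_le_self hρ (by simp; positivity)
    rw [chfTerm_succ, pow_succ, ← mul_assoc]
    have h0 := chfTerm_nonneg ha hb0 hρ (k + 1)
    exact mul_le_mul ((mul_le_of_le_one_right h0 h1).trans ih) h2 (by positivity) (by positivity)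

lemma le_chfTerm_succ {a ρ : ℝ} {N : ℕ} (ha : 0 < a) (hN : 1 ≤ N) (hρ : 0 ≤ ρ) (k : ℕ) :
    a * ρ ^ (k + 1) / ((k + 1) * (Nat.factorial (N + k) : ℝ)) ≤ chfTerm a N ρ (k + 1) := by
  have hN0 : (0 : ℝ) < N := by exact_mod_cast hN
  induction k with
  | zero =>
    have h : (N : ℝ) ≤ (Nat.factorial N : ℝ) := by exact_mod_cast Nat.self_le_factorial N
    have : a * ρ / (Nat.factorial N : ℝ) ≤ a * ρ / N := by gcongr
    simpa [chfTerm, risingFactorial, div_mul_eq_mul_div] using this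
  | succ k ih =>
    rw [chfTerm_succ]
    have h1 : ((k + 1 : ℕ) : ℝ) / (N + (k + 1 : ℕ)) ≤ (a + (k + 1 : ℕ)) / (N + (k + 1 : ℕ)) := by
      gcongr
      linarith
    calc _ = a * ρ ^ (k + 1) / ((k + 1) * (Nat.factorial (N + k) : ℝ)) *
          (((k + 1 : ℕ) : ℝ) / (N + (k + 1 : ℕ))) * (ρ / ((k + 1 : ℕ) + 1)) := by
          rw [← add_assoc N k 1, Nat.factorial_succ]
          push_cast
          field_simp
          ring
      _ ≤ _ := by
          have h0 := chfTerm_nonneg ha hN0 hρ (k + 1)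
          gcongr

lemma le_chfTerm {a ρ : ℝ} {N : ℕ} (ha : 0 < a) (haN : a ≤ N) (hρ : 0 ≤ ρ) (k : ℕ) :
    a * ρ ^ k / (Nat.factorial (k + N) : ℝ) ≤ chfTerm a N ρ k := by
  have hN : 1 ≤ N := by exact_mod_cast ha.trans_le haN
  cases k with
  | zero =>
    have h : (N : ℝ) ≤ (Nat.factorial N : ℝ) := by exact_mod_cast Nat.self_le_factorial N
    have : a / (Nat.factorial N : ℝ) ≤ 1 := (div_le_one (by positivity)).2 (haN.trans h)
    simpa [chfTerm, risingFactorial] using this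
  | succ k =>
    refine le_trans ?_ (le_chfTerm_succ ha hN hρ k)
    have : ((k : ℝ) + 1) * (Nat.factorial (N + k) : ℝ) ≤ (Nat.factorial (k + 1 + N) : ℝ) := by
      rw [show k + 1 + N = N + k + 1 by ring, Nat.factorial_succ]
      push_cast
      gcongr
      simp
    gcongr

lemma sum_pow_div_factorial_le {ρ : ℝ} (hρ : 1 ≤ ρ) (N : ℕ) :
    ∑ j ∈ Finset.range N, ρ ^ j / (Nat.factorial j : ℝ) ≤ N * ρ ^ N := by
  calc _ ≤ ∑ _j ∈ Finset.range N, ρ ^ N := by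
        refine Finset.sum_le_sum fun j hj => ?_
        refine (div_le_self (by positivity) ?_).trans
          (pow_le_pow_right₀ hρ (Finset.mem_range.1 hj).le)
        exact_mod_cast Nat.one_le_iff_ne_zero.2 (Nat.factorial_ne_zero j)
    _ = _ := by simp

lemma summable_pow_div_factorial_add (ρ : ℝ) (hρ : 0 < ρ) (N : ℕ) :
    Summable fun k : ℕ => ρ ^ k / (Nat.factorial (k + N) : ℝ) := by
  have h := ((summable_nat_add_iff N).2 (Real.summable_pow_div_factorial ρ)).div_const (ρ ^ N)
  refine h.congr fun k => ?_
  rw [pow_add]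
  field_simp

lemma exp_sub_le_tsum {ρ : ℝ} (hρ : 1 ≤ ρ) (N : ℕ) :
    Real.exp ρ - N * ρ ^ N ≤ ρ ^ N * ∑' k : ℕ, ρ ^ k / (Nat.factorial (k + N) : ℝ) := by
  have h := (Real.summable_pow_div_factorial ρ).sum_add_tsum_nat_add N
  have he : ∑' k : ℕ, ρ ^ k / (Nat.factorial k : ℝ) = Real.exp ρ := by
    rw [Real.exp_eq_exp_ℝ, NormedSpace.exp_eq_tsum_div]
  rw [he] at h
  have hs := sum_pow_div_factorial_le hρ N
  have ht : ρ ^ N * ∑' k : ℕ, ρ ^ k / (Nat.factorial (k + N) : ℝ) =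
      ∑' k : ℕ, ρ ^ (k + N) / (Nat.factorial (k + N) : ℝ) := by
    rw [← tsum_mul_left]
    refine tsum_congr fun k => ?_
    rw [pow_add]
    ring
  linarith

/-- Termwise lower bound, summed: only the terms of index below `K` can be negative. -/
lemma le_two_mul_sub_mul_CHF_M {a ρ δ : ℝ} {N K : ℕ} (ha : 0 < a) (haN : a ≤ N) (hρ : 1 ≤ ρ)
    (hδ : 0 < δ) (hK : 2 * N / δ ≤ K) :
    δ * a * ∑' k : ℕ, ρ ^ k / (Nat.factorial (k + N) : ℝ) - 3 * (1 + K * (a * ρ ^ K)) ≤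
      2 * (a / N) * CHF_M (a + 1) (N + 1) ρ - (2 - 2 * δ) * CHF_M a N ρ := by
  have hρ0 : 0 < ρ := by positivity
  have hN0 : (0 : ℝ) < N := ha.trans_le haN
  have hN1 : (1 : ℝ) ≤ N := by exact_mod_cast (show 0 < N by exact_mod_cast hN0)
  have hK0 : 0 < K := by
    have : (0 : ℝ) < K := lt_of_lt_of_le (by positivity) hK
    exact_mod_cast this
  have hs := summable_chfTerm ha haN hρ0.le
  have hs' := summable_chfTerm (show 0 < a + 1 by positivity)
    (show a + 1 ≤ (N : ℝ) + 1 by gcongr) hρ0.le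
  have hv := summable_pow_div_factorial_add ρ hρ0 N
  have hsum : ∑ k ∈ Finset.range K, 3 * ((if k = 0 then 1 else 0) + a * ρ ^ K) =
      3 * (1 + K * (a * ρ ^ K)) := by
    rw [← Finset.mul_sum, Finset.sum_add_distrib]
    simp [hK0]
  have hfin : HasSum (fun k => if k < K then 3 * ((if k = 0 then 1 else 0) + a * ρ ^ K) else 0)
      (3 * (1 + K * (a * ρ ^ K))) := by
    rw [← hsum]
    rw [Finset.sum_congr rfl fun k hk => (if_pos (Finset.mem_range.1 hk)).symm]
    exact hasSum_sum_of_ne_finset_zero fun k hk => if_neg (Finset.mem_range.not.1 hk)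
  refine hasSum_le ?_ ((hv.hasSum.mul_left (δ * a)).sub hfin)
    ((hs'.hasSum.mul_left (2 * (a / N))).sub (hs.hasSum.mul_left (2 - 2 * δ)))
  intro k
  have hu0 := chfTerm_nonneg ha hN0 hρ0.le k
  have hlow := le_chfTerm ha haN hρ0.le k
  have hcoef : 2 * (a / N) * chfTerm (a + 1) (N + 1) ρ k =
      2 * ((a + k) / (N + k)) * chfTerm a N ρ k := by
    rw [mul_assoc, div_mul_chfTerm_add_one hN0, mul_assoc]
  rw [hcoef, mul_assoc δ, ← mul_div_assoc]
  by_cases hk : k < K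
  · have hup : chfTerm a N ρ k ≤ (if k = 0 then 1 else 0) + a * ρ ^ K := by
      rcases k with _ | k
      · simp only [chfTerm, risingFactorial]
        simp
        positivity
      · have h := chfTerm_succ_le ha haN hN1 hρ0.le k
        have : a * ρ ^ (k + 1) ≤ a * ρ ^ K := by gcongr
        simpa using h.trans this
    have hq : 0 ≤ (a + k) / ((N : ℝ) + k) := by positivity
    simp only [hk, if_true]
    nlinarith [mul_nonneg hq hu0, mul_le_mul_of_nonneg_left hlow hδ.le]
  · have hKk : (K : ℝ) ≤ k := by exact_mod_cast not_lt.1 hk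
    have hq : 2 - δ ≤ 2 * ((a + k) / ((N : ℝ) + k)) := by
      rw [← mul_div_assoc, le_div_iff₀ (by positivity)]
      have := (div_le_iff₀ hδ).1 (hK.trans hKk)
      nlinarith
    simp only [hk, if_false]
    nlinarith [mul_le_mul_of_nonneg_right hq hu0, mul_le_mul_of_nonneg_left hlow hδ.le]

lemma eventually_exp_dominates {c δ : ℝ} (hc : 1 < c) (hδ : 0 < δ) (N K : ℕ) :
    ∀ᶠ ρ : ℝ in Filter.atTop,
      6 * ρ ^ N * Real.exp (ρ / c) + 3 * K * ρ ^ (K + N) + δ * N * ρ ^ N < δ * Real.exp ρ := by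
  have hd : 0 < 1 - 1 / c := by
    rw [sub_pos, div_lt_one (by positivity)]
    exact hc
  have h1 := (isLittleO_pow_exp_pos_mul_atTop N hd).def (show 0 < δ / 24 by positivity)
  have h2 := (isLittleO_pow_exp_pos_mul_atTop (K + N) one_pos).def
    (show 0 < δ / (12 * (K + 1)) by positivity)
  have h3 := (isLittleO_pow_exp_pos_mul_atTop N one_pos).def
    (show (0 : ℝ) < 1 / (4 * (N + 1)) by positivity)
  filter_upwards [h1, h2, h3, Filter.eventually_ge_atTop 0] with ρ h1 h2 h3 hρ
  simp only [Real.norm_eq_abs, abs_of_nonneg (pow_nonneg hρ _), Real.abs_exp, one_mul] at h1 h2 h3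
  have e1 : 6 * ρ ^ N * Real.exp (ρ / c) ≤ δ / 4 * Real.exp ρ := by
    have : Real.exp ((1 - 1 / c) * ρ) * Real.exp (ρ / c) = Real.exp ρ := by
      rw [← Real.exp_add]
      ring_nf
    rw [← this]
    nlinarith [Real.exp_pos (ρ / c)]
  have e2 : 3 * K * ρ ^ (K + N) ≤ δ / 4 * Real.exp ρ := by
    have : 3 * (K : ℝ) * (δ / (12 * (K + 1))) ≤ δ / 4 := by
      rw [← mul_div_assoc, div_le_div_iff₀ (by positivity) (by positivity)]
      nlinarith
    calc _ ≤ 3 * (K : ℝ) * (δ / (12 * (K + 1)) * Real.exp ρ) := by gcongr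
      _ = 3 * (K : ℝ) * (δ / (12 * (K + 1))) * Real.exp ρ := by ring
      _ ≤ _ := by gcongr
  have e3 : δ * N * ρ ^ N ≤ δ / 4 * Real.exp ρ := by
    have : δ * (N : ℝ) * (1 / (4 * (N + 1))) ≤ δ / 4 := by
      rw [← mul_div_assoc, div_le_div_iff₀ (by positivity) (by positivity)]
      nlinarith
    calc _ ≤ δ * (N : ℝ) * (1 / (4 * (N + 1)) * Real.exp ρ) := by gcongr
      _ = δ * (N : ℝ) * (1 / (4 * (N + 1))) * Real.exp ρ := by ring
      _ ≤ _ := by gcongr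
  nlinarith [Real.exp_pos ρ]

/-- For `ρ` large, twice the derivative of `M(a, N; ρ)` exceeds `(2 - 2δ) M(a, N; ρ)`, uniformly
in `a ≥ exp (-ρ / c) / 2`. -/
lemma exists_forall_lt_two_mul_CHF_M {c δ : ℝ} (hc : 1 < c) (hδ : 0 < δ) (N : ℕ) :
    ∃ R : ℝ, 1 ≤ R ∧ ∀ ρ, R ≤ ρ → ∀ a : ℝ, 0 < a → a ≤ N → 1 ≤ 2 * a * Real.exp (ρ / c) →
      (2 - 2 * δ) * CHF_M a N ρ < 2 * (a / N) * CHF_M (a + 1) (N + 1) ρ := by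
  obtain ⟨K, hK⟩ := exists_nat_ge (2 * N / δ)
  obtain ⟨R, hR⟩ := Filter.eventually_atTop.1 (eventually_exp_dominates hc hδ N K)
  refine ⟨max 1 R, le_max_left _ _, fun ρ hρ a ha haN haρ => ?_⟩
  have hρ1 : 1 ≤ ρ := (le_max_left _ _).trans hρ
  have hlt := hR ρ ((le_max_right _ _).trans hρ)
  have hmain := le_two_mul_sub_mul_CHF_M ha haN hρ1 hδ hK
  have htail := exp_sub_le_tsum hρ1 N
  set T := ∑' k : ℕ, ρ ^ k / (Nat.factorial (k + N) : ℝ)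
  have hpN : 0 < ρ ^ N := by positivity
  suffices h : 0 < ρ ^ N * (δ * a * T - 3 * (1 + K * (a * ρ ^ K))) by
    linarith [pos_of_mul_pos_right h hpN.le]
  have h1 : 3 * ρ ^ N ≤ a * (6 * ρ ^ N * Real.exp (ρ / c)) := by nlinarith
  have h2 := mul_lt_mul_of_pos_left hlt ha
  have h3 := mul_le_mul_of_nonneg_left htail (mul_pos hδ ha).le
  rw [pow_add] at h2
  linarith

/-- Let `n ≥ 2`, `m = (n−3)/2`, `κ > 0`, `|γ| < κ/(2(m+1))`, and `c > 1`.  Then there exists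
`z₀ ∈ (0, m+1)` such that for every `z ∈ (z₀, m+1)` and every `ρ ≥ ρ₊(z) = c log((m+1)/(m+1−z))`,
with `a₀ = m + 1 − z` and `b₀ = 2m + 2`, one has
`2 (a₀/b₀) M(a₀+1,b₀+1;ρ) > (1 − 2γz/κ) M(a₀,b₀;ρ)`. -/
theorem transcendental_pos_above (n : ℕ) (hn : 2 ≤ n) (m : ℝ) (hm : m = ((n : ℝ) - 3) / 2)
    (κ γ : ℝ) (hκ : 0 < κ) (hγ : |γ| < κ / (2 * (m + 1))) (c : ℝ) (hc : 1 < c) :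
    ∃ z₀ ∈ Set.Ioo (0 : ℝ) (m + 1), ∀ z ∈ Set.Ioo z₀ (m + 1),
      ∀ ρ : ℝ, c * Real.log ((m + 1) / (m + 1 - z)) ≤ ρ →
        2 * ((m + 1 - z) / (2 * m + 2)) * CHF_M (m + 1 - z + 1) (2 * m + 2 + 1) ρ
          > (1 - 2 * γ * z / κ) * CHF_M (m + 1 - z) (2 * m + 2) ρ := by
  obtain ⟨N, rfl⟩ : ∃ N, n = N + 1 := ⟨n - 1, by omega⟩
  have hN : (1 : ℝ) ≤ N := by exact_mod_cast (show 1 ≤ N by omega)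
  have hb : 2 * m + 2 = N := by
    rw [hm]
    push_cast
    ring
  have hm0 : 1 / 2 ≤ m + 1 := by linarith
  have hmpos : 0 < m + 1 := by linarith
  set θ := 2 * |γ| * (m + 1) / κ with hθ
  have hθ0 : 0 ≤ θ := by positivity
  have hθ1 : θ < 1 := by
    rw [lt_div_iff₀ (by positivity)] at hγ
    rw [hθ, div_lt_one hκ]
    linarith
  obtain ⟨R, hR1, hR⟩ := exists_forall_lt_two_mul_CHF_M hc (show 0 < (1 - θ) / 2 by linarith) N
  have hc0 : 0 < c := by linarith
  have hexp : Real.exp (-(R / c)) < 1 := by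
    rw [← Real.exp_zero, Real.exp_lt_exp, neg_lt_zero]
    positivity
  refine ⟨(m + 1) * (1 - Real.exp (-(R / c))), ⟨by apply mul_pos hmpos; linarith,
    by nlinarith [Real.exp_pos (-(R / c))]⟩, fun z hz ρ hρ => ?_⟩
  obtain ⟨hz0, hz1⟩ := hz
  have hzpos : 0 < z := lt_trans (by apply mul_pos hmpos; linarith) hz0
  have ha : 0 < m + 1 - z := by linarith
  have hlog : Real.log ((m + 1) / (m + 1 - z)) ≤ ρ / c := by
    rw [le_div_iff₀ hc0]
    linarith
  have hRρ : R ≤ ρ := by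
    refine le_trans ?_ hρ
    rw [← div_le_iff₀' hc0, Real.le_log_iff_exp_le (by positivity), le_div_iff₀ ha]
    have h1 : m + 1 - z ≤ (m + 1) * Real.exp (-(R / c)) := by linarith
    have h2 : Real.exp (R / c) * Real.exp (-(R / c)) = 1 := by
      rw [← Real.exp_add]
      simp
    calc _ ≤ Real.exp (R / c) * ((m + 1) * Real.exp (-(R / c))) := by gcongr
      _ = (m + 1) * (Real.exp (R / c) * Real.exp (-(R / c))) := by ring
      _ = m + 1 := by rw [h2, mul_one]
  have haρ : 1 ≤ 2 * (m + 1 - z) * Real.exp (ρ / c) := by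
    rw [Real.log_le_iff_le_exp (by positivity), div_le_iff₀ ha] at hlog
    linarith
  have haN : m + 1 - z ≤ N := by linarith
  have hmain := hR ρ hRρ (m + 1 - z) ha haN haρ
  have hM : 0 ≤ CHF_M (m + 1 - z) N ρ :=
    tsum_nonneg (chfTerm_nonneg ha (by positivity) (by linarith))
  have hcoef : 1 - 2 * γ * z / κ ≤ 2 - 2 * ((1 - θ) / 2) := by
    have : -(2 * γ * z / κ) ≤ θ := by
      rw [hθ, ← neg_div]
      gcongr
      nlinarith [neg_abs_le γ, abs_nonneg γ]
    linarith
  rw [hb]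
  exact (mul_le_mul_of_nonneg_right hcoef hM).trans_lt hmain
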